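/- Let (η_j)_{j≥1} be a sequence of pairwise distinct complex numbers. Then for every entire function f : ℂ² → ℂ, every N ≥ 1, and every p with 1 ≤ p ≤ N, the function E_N(f;η) coincides with f on the complex line {z ∈ ℂ² : z_1 = η_p z_2}; that is, E_N(f;η)(η_p w, w) = f(η_p w, w) for all w ∈ ℂ. -/

import Mathlib

open Complex Filter

/-- Divided differences: `divDiff η g p w` is `Δ_{p,(η_p,…,η_1)}(g)(w)`. -/
noncomputable def divDiff (η : ℕ → ℂ) (g : ℂ → ℂ) : ℕ → ℂ → ℂ
  | 0, w => g w
  | p + 1, w => (divDiff η g p w - divDiff η g p (η (p + 1))) / (w - η (p + 1))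

/-- The interpolation formula `E_N(f;η)(z)`. -/
noncomputable def EN (η : ℕ → ℂ) (f : ℂ × ℂ → ℂ) (N : ℕ) (z : ℂ × ℂ) : ℂ :=
  ∑ p ∈ Finset.Icc 1 N,
    (∏ j ∈ Finset.Icc (p + 1) N, (z.1 - η j * z.2)) *
      ∑ q ∈ Finset.Icc p N,
        ((1 + η p * (starRingEnd ℂ) (η q)) / (1 + (Complex.normSq (η q) : ℂ))) *
          (∏ j ∈ (Finset.Icc p N).erase q, (η q - η j))⁻¹ *
            ∑' m : ℕ,
              ((z.2 + (starRingEnd ℂ) (η q) * z.1) / (1 + (Complex.normSq (η q) : ℂ))) ^ m *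
                (((m + (N - p)).factorial : ℂ))⁻¹ *
                  iteratedDeriv (m + (N - p)) (fun v => f (η q * v, v)) 0

open Complex Filter in
/-- The `m`-th Taylor coefficients along lines behave like polynomials of degree `≤ m`. -/
lemma aux_line {ι : Type*} (f : ℂ × ℂ → ℂ) (hf : Differentiable ℂ f) (s : Finset ι)
    (c x : ι → ℂ) (m : ℕ) (h : ∀ k ≤ m, ∑ i ∈ s, c i * x i ^ k = 0) :
    ∑ i ∈ s, c i * iteratedDeriv m (fun v => f (x i * v, v)) 0 = 0 := by
  obtain ⟨A, hA1, hA⟩ : ∃ A : ℝ, 1 ≤ A ∧ ∀ i ∈ s, ‖x i‖ ≤ A := by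
    refine ⟨1 + ∑ i ∈ s, ‖x i‖, ?_, ?_⟩
    · have := Finset.sum_nonneg (fun i (_ : i ∈ s) => norm_nonneg (x i)); linarith
    · intro i hi
      have := Finset.single_le_sum (fun i (_ : i ∈ s) => norm_nonneg (x i)) hi
      linarith
  obtain ⟨M, hM⟩ : ∃ M : ℝ, ∀ z ∈ Metric.closedBall (0:ℂ) 1 ×ˢ Metric.closedBall (0:ℂ) 1,
      ‖f z‖ ≤ M :=
    ((isCompact_closedBall _ _).prod (isCompact_closedBall _ _)).exists_bound_of_continuousOn
      hf.continuous.continuousOn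
  have hM0 : 0 ≤ M := (norm_nonneg _).trans (hM (0, 0) (by simp))
  set S := ∑ i ∈ s, ‖c i‖ with hS
  have hS0 : 0 ≤ S := Finset.sum_nonneg fun i _ => norm_nonneg _
  set H : ℂ → ℂ := fun v => ∑ i ∈ s, c i * f (x i * v, v) with hH
  have hline : ∀ i, Differentiable ℂ (fun v => f (x i * v, v)) := fun i =>
    hf.comp (by fun_prop)
  have hHd : Differentiable ℂ H := by
    rw [hH]
    refine Differentiable.fun_sum fun i _ => ?_
    exact (hline i).const_mul _
  have hHm : iteratedDeriv m H 0
      = ∑ i ∈ s, c i * iteratedDeriv m (fun v => f (x i * v, v)) 0 := by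
    rw [hH, iteratedDeriv_fun_sum]
    · refine Finset.sum_congr rfl fun i _ => ?_
      rw [iteratedDeriv_const_mul_field]
    · intro i _
      exact (((hline i).const_mul _).contDiff).contDiffAt
  rw [← hHm]
  -- bound on H
  have hbound : ∀ v : ℂ, A * ‖v‖ ≤ 1 / 2 → ‖H v‖ ≤ (2 * M * S) * (A * ‖v‖) ^ (m + 1) := by
    intro v hv
    have hv1 : ‖v‖ ≤ 1 := by nlinarith [norm_nonneg v]
    have hgd : Differentiable ℂ (fun u => f (u, v)) := hf.comp (by fun_prop)
    set a : ℕ → ℂ := fun k => (k.factorial : ℂ)⁻¹ * iteratedDeriv k (fun u => f (u, v)) 0 with ha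
    have hsum : ∀ u, HasSum (fun k => a k * u ^ k) (f (u, v)) := by
      intro u
      have := Complex.hasSum_taylorSeries_of_entire hgd 0 u
      simpa [ha, smul_eq_mul, mul_assoc, mul_comm, mul_left_comm] using this
    have hab : ∀ k, ‖a k‖ ≤ M := by
      intro k
      have := Complex.norm_iteratedDeriv_le_of_forall_mem_sphere_norm_le (n := k) (c := 0)
        (R := 1) (C := M) (f := fun u => f (u, v)) one_pos hgd.diffContOnCl (by
          intro z hz
          apply hM
          simp at hz
          simp [hz, hv1])
      simp only [ha, norm_mul, norm_inv, Complex.norm_natCast]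
      rw [inv_mul_le_iff₀ (by positivity)]
      simpa using this
    have hHs : HasSum (fun k => ∑ i ∈ s, c i * (a k * (x i * v) ^ k)) (H v) :=
      hasSum_sum fun i _ => (hsum _).mul_left _
    have hterm : ∀ k, ∑ i ∈ s, c i * (a k * (x i * v) ^ k)
        = a k * v ^ k * ∑ i ∈ s, c i * x i ^ k := by
      intro k
      rw [Finset.mul_sum]
      refine Finset.sum_congr rfl fun i _ => ?_
      rw [mul_pow]; ring
    have hsh : HasSum (fun k => ∑ i ∈ s, c i * (a (k + (m + 1)) * (x i * v) ^ (k + (m + 1)))) (H v) := by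
      have := (hasSum_nat_add_iff' (m + 1)).mpr hHs
      rwa [Finset.sum_eq_zero, sub_zero] at this
      intro k hk
      rw [hterm, h k (by simpa [Nat.lt_succ_iff] using hk), mul_zero]
    have hgeo : HasSum (fun k => (M * S * (A * ‖v‖) ^ (m + 1)) * (1 / 2 : ℝ) ^ k)
        ((M * S * (A * ‖v‖) ^ (m + 1)) * 2) := hasSum_geometric_two.mul_left _
    have hle := hsh.norm_le_of_bounded hgeo (by
      intro k
      calc ‖∑ i ∈ s, c i * (a (k + (m + 1)) * (x i * v) ^ (k + (m + 1)))‖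
          ≤ ∑ i ∈ s, ‖c i‖ * (M * (A * ‖v‖) ^ (k + (m + 1))) := by
            refine norm_sum_le_of_le _ fun i hi => ?_
            rw [norm_mul, norm_mul (a _), norm_pow, norm_mul (x i)]
            have h1 := hab (k + (m + 1))
            have h2 : (‖x i‖ * ‖v‖) ^ (k + (m + 1)) ≤ (A * ‖v‖) ^ (k + (m + 1)) :=
              pow_le_pow_left₀ (by positivity)
                (mul_le_mul_of_nonneg_right (hA i hi) (norm_nonneg _)) _
            exact mul_le_mul_of_nonneg_left
              (mul_le_mul h1 h2 (by positivity) hM0) (norm_nonneg _)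
        _ = M * S * (A * ‖v‖) ^ (m + 1) * (A * ‖v‖) ^ k := by
            rw [← Finset.sum_mul, ← hS, pow_add]; ring
        _ ≤ _ := by gcongr)
    linarith
  -- Cauchy estimate
  have hest : ∀ r : ℝ, 0 < r → A * r ≤ 1 / 2 →
      ‖iteratedDeriv m H 0‖ ≤ (m.factorial * (2 * M * S) * A ^ (m + 1)) * r := by
    intro r hr hAr
    have := Complex.norm_iteratedDeriv_le_of_forall_mem_sphere_norm_le (n := m) (c := 0)
        (R := r) (C := (2 * M * S) * (A * r) ^ (m + 1)) (f := H) hr hHd.diffContOnCl (by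
          intro z hz
          simp at hz
          have := hbound z (by rw [hz]; exact hAr)
          rwa [hz] at this)
    refine this.trans (le_of_eq ?_)
    rw [mul_pow]
    field_simp
    ring
  by_contra hne
  have hpos : 0 < ‖iteratedDeriv m H 0‖ := norm_pos_iff.mpr hne
  set K := (m.factorial * (2 * M * S) * A ^ (m + 1)) with hK
  have hK0 : 0 ≤ K := by positivity
  set r := min (1 / (2 * A)) (‖iteratedDeriv m H 0‖ / (2 * (K + 1))) with hr
  have hr0 : 0 < r := by rw [hr]; positivity
  have h1 : A * r ≤ 1 / 2 := by
    calc A * r ≤ A * (1 / (2 * A)) := by gcongr; exact min_le_left _ _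
      _ = 1 / 2 := by field_simp
  have h2 := hest r hr0 h1
  have h3 : (K + 1) * r ≤ ‖iteratedDeriv m H 0‖ / 2 := by
    calc (K + 1) * r ≤ (K + 1) * (‖iteratedDeriv m H 0‖ / (2 * (K + 1))) := by
          gcongr; exact min_le_right _ _
      _ = _ := by field_simp
  linarith

/-- Telescoping identity. -/
lemma aux_tele (η : ℕ → ℂ) (N q : ℕ) (hq : q ≤ N) (c y : ℂ) (d : ℕ) :
    ∀ s, s + d = q → (∀ j ∈ Finset.Icc s N, j ≠ q → η q ≠ η j) →
    ∑ p ∈ Finset.Icc s q, (1 + c * (η p - η q)) * (1 + c * (y - η q)) ^ (p - s) *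
      (∏ j ∈ Finset.Icc (p + 1) N, (y - η j)) *
      (∏ j ∈ (Finset.Icc p N).erase q, (η q - η j))⁻¹
    = ∏ j ∈ (Finset.Icc s N).erase q, ((y - η j) / (η q - η j)) := by
  induction d with
  | zero =>
    intro s hs _
    obtain rfl : s = q := by simpa using hs
    have : (Finset.Icc s N).erase s = Finset.Icc (s + 1) N := by
      ext j; simp only [Finset.mem_erase, Finset.mem_Icc]; omega
    rw [Finset.prod_div_distrib]
    simp [this, div_eq_mul_inv]
  | succ d ih =>
    intro s hs hd
    have hsq : s ≠ q := by omega
    have e1 : Finset.Icc s q = insert s (Finset.Icc (s + 1) q) := by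
      ext j; simp; omega
    have e2 : (Finset.Icc s N).erase q = insert s ((Finset.Icc (s + 1) N).erase q) := by
      ext j; simp; omega
    have ih' := ih (s + 1) (by omega) (fun j hj => hd j (by simp at hj ⊢; omega))
    have e3 : Finset.Icc (s + 1) N = insert q ((Finset.Icc (s + 1) N).erase q) := by
      rw [Finset.insert_erase]; simp; omega
    rw [e1, Finset.sum_insert (by simp)]
    have e4 : ∑ p ∈ Finset.Icc (s + 1) q, (1 + c * (η p - η q)) * (1 + c * (y - η q)) ^ (p - s) *
      (∏ j ∈ Finset.Icc (p + 1) N, (y - η j)) *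
      (∏ j ∈ (Finset.Icc p N).erase q, (η q - η j))⁻¹ = (1 + c * (y - η q)) *
        ∏ j ∈ (Finset.Icc (s + 1) N).erase q, ((y - η j) / (η q - η j)) := by
      rw [← ih', Finset.mul_sum]
      refine Finset.sum_congr rfl fun p hp => ?_
      have : p - s = (p - (s + 1)) + 1 := by simp at hp; omega
      rw [this, pow_succ]; ring
    have e5 : ∏ j ∈ Finset.Icc (s + 1) N, (y - η j) =
        (y - η q) * ∏ j ∈ (Finset.Icc (s + 1) N).erase q, (y - η j) := by
      conv_lhs => rw [e3]
      rw [Finset.prod_insert (by simp)]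
    rw [e4, e2, Finset.prod_insert (by simp), Finset.prod_insert (by simp), e5]
    rw [Finset.prod_div_distrib]
    simp only [Nat.sub_self, pow_zero, div_eq_mul_inv, mul_inv]
    have hne : η q - η s ≠ 0 := sub_ne_zero.mpr (hd s (by simp; omega) hsq)
    field_simp
    ring

lemma aux_norm (z : ℂ) : (1 + (Complex.normSq z : ℂ)) ≠ 0 := by
  have : (0:ℝ) < 1 + Complex.normSq z := by have := Complex.normSq_nonneg z; linarith
  exact_mod_cast this.ne'

lemma aux_t (x z : ℂ) : (1 + x * (starRingEnd ℂ) z) / (1 + (Complex.normSq z : ℂ))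
    = 1 + ((starRingEnd ℂ) z / (1 + (Complex.normSq z : ℂ))) * (x - z) := by
  have h := aux_norm z
  have h2 : (Complex.normSq z : ℂ) = z * (starRingEnd ℂ) z := (Complex.mul_conj z).symm
  field_simp
  rw [h2]; ring

/-- Coefficient identity. -/
lemma aux_coeff (η : ℕ → ℂ) (hdist : ∀ i j, 1 ≤ i → 1 ≤ j → i ≠ j → η i ≠ η j)
    (N r m : ℕ) (hr1 : 1 ≤ r) (hrN : r ≤ N) (a c : ℕ → ℂ)
    (ha : m < N - r → ∑ q ∈ Finset.Icc (N - m) N,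
      (∏ j ∈ (Finset.Icc (N - m) N).erase q, ((η r - η j) / (η q - η j))) * a q = a r) :
    ∑ p ∈ Finset.Icc 1 N, ∑ q ∈ Finset.Icc p N,
      (∏ j ∈ Finset.Icc (p + 1) N, (η r - η j)) *
        ((1 + c q * (η p - η q)) * (∏ j ∈ (Finset.Icc p N).erase q, (η q - η j))⁻¹ *
          (if N - p ≤ m then (1 + c q * (η r - η q)) ^ (m - (N - p)) * a q else 0)) = a r := by
  obtain ⟨s, hs⟩ : ∃ s, s = max r (N - m) := ⟨_, rfl⟩
  have step1 : ∑ p ∈ Finset.Icc 1 N, ∑ q ∈ Finset.Icc p N,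
      (∏ j ∈ Finset.Icc (p + 1) N, (η r - η j)) *
        ((1 + c q * (η p - η q)) * (∏ j ∈ (Finset.Icc p N).erase q, (η q - η j))⁻¹ *
          (if N - p ≤ m then (1 + c q * (η r - η q)) ^ (m - (N - p)) * a q else 0))
      = ∑ p ∈ Finset.Icc s N, ∑ q ∈ Finset.Icc p N,
        (1 + c q * (η r - η q)) ^ (m + s - N) * a q *
        ((1 + c q * (η p - η q)) * (1 + c q * (η r - η q)) ^ (p - s) *
        (∏ j ∈ Finset.Icc (p + 1) N, (η r - η j)) *
        (∏ j ∈ (Finset.Icc p N).erase q, (η q - η j))⁻¹) := by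
    symm
    have hsub : Finset.Icc s N ⊆ Finset.Icc 1 N := by
      intro j; simp; omega
    rw [← Finset.sum_subset hsub]
    · refine Finset.sum_congr rfl fun p hp => Finset.sum_congr rfl fun q hq => ?_
      simp at hp hq
      rw [if_pos (by omega)]
      have : m - (N - p) = (m + s - N) + (p - s) := by omega
      rw [this, pow_add]; ring
    · intro p hp hps
      simp at hp hps
      refine Finset.sum_eq_zero fun q hq => ?_
      by_cases hpr : p < r
      · rw [Finset.prod_eq_zero (i := r) (by simp; omega) (sub_self _), zero_mul]
      · rw [if_neg (by omega)]; simp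
  rw [step1]
  have step2 : ∑ p ∈ Finset.Icc s N, ∑ q ∈ Finset.Icc p N,
        (1 + c q * (η r - η q)) ^ (m + s - N) * a q *
        ((1 + c q * (η p - η q)) * (1 + c q * (η r - η q)) ^ (p - s) *
        (∏ j ∈ Finset.Icc (p + 1) N, (η r - η j)) *
        (∏ j ∈ (Finset.Icc p N).erase q, (η q - η j))⁻¹)
      = ∑ q ∈ Finset.Icc s N, (1 + c q * (η r - η q)) ^ (m + s - N) * a q *
        ∏ j ∈ (Finset.Icc s N).erase q, ((η r - η j) / (η q - η j)) := by
    rw [Finset.sum_comm' (s' := fun q => Finset.Icc s q) (t' := Finset.Icc s N)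
      (by intro p q; simp; omega)]
    refine Finset.sum_congr rfl fun q hq => ?_
    simp at hq
    rw [← Finset.mul_sum, aux_tele η N q hq.2 (c q) (η r) (q - s) s (by omega)]
    intro j hj hjq
    simp at hj
    exact hdist q j (by omega) (by omega) (Ne.symm hjq)
  rw [step2]
  by_cases hm : m < N - r
  · have hsm : s = N - m := by omega
    have h0 : m + s - N = 0 := by omega
    rw [← ha hm, h0, hsm]
    refine Finset.sum_congr rfl fun q _ => ?_
    ring
  · have hsr : s = r := by omega
    rw [hsr, Finset.sum_eq_single r]
    · rw [Finset.prod_congr rfl (g := fun _ => (1:ℂ))]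
      · simp
      · intro j hj
        simp only [Finset.mem_erase, Finset.mem_Icc] at hj
        exact div_self (sub_ne_zero.mpr (hdist r j hr1 (by omega) (Ne.symm hj.1)))
    · intro q hq hqr
      rw [Finset.prod_eq_zero (i := r) (by simp; omega) (by simp), mul_zero]
    · intro h; exact absurd (Finset.mem_Icc.mpr ⟨le_rfl, hrN⟩) h

lemma aux_lagrange (η : ℕ → ℂ) (s : Finset ℕ) (hs : Set.InjOn η s) (y : ℂ) (k : ℕ)
    (hk : k < s.card) :
    ∑ q ∈ s, (∏ j ∈ s.erase q, ((y - η j) / (η q - η j))) * η q ^ k = y ^ k := by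
  have h := Lagrange.eq_interpolate (f := (Polynomial.X ^ k : Polynomial ℂ)) hs (by
    rw [Polynomial.degree_X_pow]; exact_mod_cast hk)
  have h2 := congrArg (Polynomial.eval y) h
  rw [Lagrange.interpolate_apply, Polynomial.eval_finsetSum] at h2
  simp only [Polynomial.eval_pow, Polynomial.eval_X, Polynomial.eval_mul, Polynomial.eval_C,
    Lagrange.basis, Polynomial.eval_prod, Lagrange.basisDivisor, Polynomial.eval_sub] at h2
  rw [h2]
  refine Finset.sum_congr rfl fun q _ => ?_
  rw [mul_comm]
  congr 1
  refine Finset.prod_congr rfl fun j _ => ?_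
  rw [div_eq_mul_inv, mul_comm]

lemma aux_shift (a : ℕ → ℂ) (k : ℕ) (T w : ℂ) (ha : ∀ x, Summable fun m => x ^ m * a m) :
    HasSum (fun m => if k ≤ m then w ^ m * (T ^ (m - k) * a m) else 0)
      (w ^ k * ∑' m, (T * w) ^ m * a (m + k)) := by
  have hsum : ∀ x : ℂ, Summable fun m => x ^ m * a (m + k) := by
    intro x
    by_cases hx : x = 0
    · refine summable_of_ne_finset_zero (s := {0}) fun m hm => ?_
      simp at hm
      simp [hx, hm]
    · have := ((summable_nat_add_iff k).mpr (ha x)).mul_left ((x ^ k)⁻¹)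
      refine this.congr fun m => ?_
      rw [pow_add]; field_simp
  have h1 := (hsum (T * w)).hasSum.mul_left (w ^ k)
  rw [← (add_left_injective k).hasSum_iff]
  · refine h1.congr_fun ?_ |> fun h => h
    intro m
    simp [mul_pow, pow_add]; ring
  · intro m hm
    rw [if_neg]
    intro hkm
    exact hm ⟨m - k, by simp; omega⟩

theorem stmt5 (η : ℕ → ℂ)
    (hdist : ∀ i j, 1 ≤ i → 1 ≤ j → i ≠ j → η i ≠ η j)
    (f : ℂ × ℂ → ℂ) (hf : Differentiable ℂ f)
    (N p : ℕ) (hN : 1 ≤ N) (hp1 : 1 ≤ p) (hpN : p ≤ N) (w : ℂ) :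
    EN η f N (η p * w, w) = f (η p * w, w) := by
  obtain ⟨a, ha⟩ : ∃ a : ℕ → ℕ → ℂ, ∀ q m, a q m =
      (m.factorial : ℂ)⁻¹ * iteratedDeriv m (fun v => f (η q * v, v)) 0 := ⟨_, fun _ _ => rfl⟩
  have hsum : ∀ q v, HasSum (fun m => v ^ m * a q m) (f (η q * v, v)) := by
    intro q v
    have hd : Differentiable ℂ (fun v => f (η q * v, v)) := hf.comp (by fun_prop)
    have := Complex.hasSum_taylorSeries_of_entire hd 0 v
    simpa [ha, smul_eq_mul, mul_assoc, mul_comm, mul_left_comm] using this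
  obtain ⟨c, hc⟩ : ∃ c : ℕ → ℂ, ∀ q, c q =
    (starRingEnd ℂ) (η q) / (1 + (Complex.normSq (η q) : ℂ)) := ⟨_, fun _ => rfl⟩
  have hcoeff : ∀ m, ∑ k ∈ Finset.Icc 1 N, ∑ q ∈ Finset.Icc k N,
      (∏ j ∈ Finset.Icc (k + 1) N, (η p - η j)) *
        ((1 + c q * (η k - η q)) * (∏ j ∈ (Finset.Icc k N).erase q, (η q - η j))⁻¹ *
          (if N - k ≤ m then (1 + c q * (η p - η q)) ^ (m - (N - k)) * a q m else 0))
        = a p m := by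
    intro m
    refine aux_coeff η hdist N p m hp1 hpN (fun q => a q m) c fun hm => ?_
    have hinj : Set.InjOn η (Finset.Icc (N - m) N : Finset ℕ) := by
      intro i hi j hj hij
      simp at hi hj
      by_contra hne
      exact hdist i j (by omega) (by omega) hne hij
    have hlag := fun k hk => aux_lagrange η (Finset.Icc (N - m) N) hinj (η p) k hk
    have hnot : p ∉ Finset.Icc (N - m) N := by simp; omega
    set C : ℕ → ℂ := fun q => if q = p then -1 else
      ∏ j ∈ (Finset.Icc (N - m) N).erase q, ((η p - η j) / (η q - η j)) with hC
    have hCq : ∀ q ∈ Finset.Icc (N - m) N, C q =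
        ∏ j ∈ (Finset.Icc (N - m) N).erase q, ((η p - η j) / (η q - η j)) := by
      intro q hq
      simp only [hC]
      rw [if_neg]
      rintro rfl
      exact hnot hq
    have hCp : C p = -1 := by simp [hC]
    have key := aux_line f hf (insert p (Finset.Icc (N - m) N)) C η m (by
      intro k hk
      rw [Finset.sum_insert hnot, hCp,
        Finset.sum_congr rfl (fun q hq => by rw [hCq q hq]), hlag k (by simp; omega)]
      ring)
    rw [Finset.sum_insert hnot, hCp, Finset.sum_congr rfl (fun q hq => by rw [hCq q hq])] at key
    simp only [ha]
    have key2 : iteratedDeriv m (fun v => f (η p * v, v)) 0 = _ :=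
      (by linear_combination -key : _ = ∑ q ∈ Finset.Icc (N - m) N,
        (∏ j ∈ (Finset.Icc (N - m) N).erase q, ((η p - η j) / (η q - η j))) *
        iteratedDeriv m (fun v => f (η q * v, v)) 0)
    rw [key2, Finset.mul_sum]
    refine Finset.sum_congr rfl fun q _ => ?_
    ring
  have hbig := hasSum_sum (s := Finset.Icc 1 N) fun k (_ : k ∈ Finset.Icc 1 N) =>
    hasSum_sum (s := Finset.Icc k N) fun q (_ : q ∈ Finset.Icc k N) =>
      (aux_shift (a q) (N - k) (1 + c q * (η p - η q)) w
        (fun x => (hsum q x).summable)).mul_left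
        ((∏ j ∈ Finset.Icc (k + 1) N, (η p - η j)) *
          ((1 + c q * (η k - η q)) * (∏ j ∈ (Finset.Icc k N).erase q, (η q - η j))⁻¹))
  have hfin := hsum p w
  refine HasSum.unique ?_ hfin
  have hEN : EN η f N (η p * w, w) = ∑ k ∈ Finset.Icc 1 N, ∑ q ∈ Finset.Icc k N,
      (∏ j ∈ Finset.Icc (k + 1) N, (η p - η j)) *
          ((1 + c q * (η k - η q)) * (∏ j ∈ (Finset.Icc k N).erase q, (η q - η j))⁻¹) *
        (w ^ (N - k) * ∑' m : ℕ, ((1 + c q * (η p - η q)) * w) ^ m * a q (m + (N - k))) := by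
    unfold EN
    refine Finset.sum_congr rfl fun k _ => ?_
    rw [Finset.mul_sum]
    refine Finset.sum_congr rfl fun q _ => ?_
    have e1 : ∏ j ∈ Finset.Icc (k + 1) N, (η p * w - η j * w)
        = w ^ (N - k) * ∏ j ∈ Finset.Icc (k + 1) N, (η p - η j) := by
      simp only [← sub_mul, Finset.prod_mul_distrib, Finset.prod_const, Nat.card_Icc]
      rw [mul_comm, Nat.add_sub_add_right]
    have e2 : (w + (starRingEnd ℂ) (η q) * (η p * w)) / (1 + (Complex.normSq (η q) : ℂ))
        = (1 + c q * (η p - η q)) * w := by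
      rw [hc, ← aux_t]; ring
    simp only [e1, e2, aux_t (η k) (η q), ← hc q, ha, mul_assoc]
    ring
  rw [hEN]
  refine hbig.congr_fun fun m => ?_
  rw [← hcoeff m, Finset.mul_sum]
  refine Finset.sum_congr rfl fun k _ => ?_
  rw [Finset.mul_sum]
  refine Finset.sum_congr rfl fun q _ => ?_
  split_ifs <;> ring
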